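/- arXiv:1803.06858 — 2 statements merged into one kernel-verified Lean document; each statement's English description precedes it below -/
import Mathlib

section
/- Let Γ be a finite group and p a prime. If the group ℤ/pℤ × ℤ/pℤ is a section of Γ, then Γ contains a subgroup isomorphic to ℤ/pℤ × ℤ/pℤ, or p = 2 and every Sylow 2-subgroup of Γ is a generalized quaternion group. -/
/-- `Q` is a generalized quaternion group: isomorphic to the dicyclic group of
order `2^m` for some `m ≥ 3`. -/
def IsGeneralizedQuaternion (Q : Type*) [Group Q] : Prop :=
  ∃ m : ℕ, 3 ≤ m ∧ Nonempty (Q ≃* QuaternionGroup (2 ^ (m - 2)))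

/-- `Δ` is a section of `Γ`: a quotient of a subgroup of `Γ`, equivalently there is
a subgroup of `Γ` mapping onto `Δ`. -/
def IsSection (Δ Γ : Type*) [Group Δ] [Group Γ] : Prop :=
  ∃ (H : Subgroup Γ) (f : H →* Δ), Function.Surjective f

/-- A nontrivial normal subgroup of a finite `p`-group contains a central element of order `p`. -/
theorem IsPGroup.exists_mem_center_orderOf_eq {p : ℕ} [Fact p.Prime] {G : Type*} [Group G]
    [Finite G] (hG : IsPGroup p G) (N : Subgroup G) [N.Normal] (hN : N ≠ ⊥) :
    ∃ g ∈ N, g ∈ Subgroup.center G ∧ orderOf g = p := by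
  have hNt : Nontrivial N := (Subgroup.nontrivial_iff_ne_bot N).2 hN
  have hdvd : p ∣ Nat.card N :=
    ((hG.to_subgroup N).card_eq_or_dvd).resolve_left (Finite.one_lt_card.ne')
  obtain ⟨b, hb, hb1⟩ := (hG.of_equiv ConjAct.toConjAct)
    |>.exists_fixed_point_of_prime_dvd_card_of_fixed_point N hdvd (a := 1)
      (fun g => smul_one g)
  have hbc : (b : G) ∈ Subgroup.center G := by
    rw [Subgroup.mem_center_iff]
    intro g
    have h := congrArg (Subtype.val : N → G) (hb (ConjAct.toConjAct g))
    rw [ConjAct.Subgroup.val_conj_smul, ConjAct.toConjAct_smul, mul_inv_eq_iff_eq_mul] at h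
    exact h
  have hb1' : (b : G) ≠ 1 := fun h => hb1 (Subtype.ext h.symm)
  refine ⟨(b : G) ^ (orderOf (b : G) / p), N.pow_mem b.2 _,
    Subgroup.pow_mem _ hbc _, ?_⟩
  exact orderOf_pow_orderOf_div (orderOf_pos _).ne' (hG.dvd_orderOf hb1')

theorem IsPGroup.mem_zpowers_zpow {p : ℕ} (hp : p.Prime) {G : Type*} [Group G]
    (hG : IsPGroup p G) (a : G) {j : ℤ} (hj : ¬ (p : ℤ) ∣ j) : a ∈ Subgroup.zpowers (a ^ j) := by
  have : Fact p.Prime := ⟨hp⟩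
  obtain ⟨n, hn⟩ := IsPGroup.iff_orderOf.1 hG a
  have hco : IsCoprime (orderOf a : ℤ) j := by
    rw [hn, Nat.cast_pow]
    exact ((Nat.prime_iff_prime_int.1 hp).coprime_iff_not_dvd.2 hj).pow_left
  obtain ⟨r, s, hrs⟩ := hco
  refine ⟨s, ?_⟩
  change (a ^ j) ^ s = a
  rw [← zpow_mul]
  calc a ^ (j * s) = a ^ (1 : ℤ) := by
        rw [zpow_eq_zpow_iff_modEq, Int.modEq_iff_dvd]
        exact ⟨r, by linear_combination -hrs⟩
    _ = a := zpow_one a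

theorem Nat.Prime.exists_pow_dvd_mul_add {p n : ℕ} (hp : p.Prime) {u v : ℤ} (hu : ¬ (p : ℤ) ∣ u) :
    ∃ i : ℤ, ((p ^ n : ℕ) : ℤ) ∣ i * (p * u) + p * v := by
  have hco : IsCoprime ((p ^ n : ℕ) : ℤ) u := by
    push_cast
    exact ((Nat.prime_iff_prime_int.1 hp).coprime_iff_not_dvd.2 hu).pow_left
  obtain ⟨r, s, hrs⟩ := hco
  exact ⟨-v * s, p * v * r, by linear_combination (-(p : ℤ) * v) * hrs⟩

theorem Int.exists_geom_sum_eq_mul {p : ℕ} (hp : p.Prime) {k : ℤ} (hk : (p : ℤ) ∣ k - 1)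
    (h2 : p = 2 → (4 : ℤ) ∣ k - 1) :
    ∃ u : ℤ, ∑ t ∈ Finset.range p, k ^ t = p * u ∧ ¬ (p : ℤ) ∣ u := by
  rcases hp.eq_two_or_odd' with rfl | hodd
  · obtain ⟨m, hm⟩ := h2 rfl
    refine ⟨1 + 2 * m, ?_, by push_cast; omega⟩
    simp [Finset.sum_range_succ]
    linarith
  · obtain ⟨m, hm⟩ := hk
    obtain ⟨c, hc⟩ := odd_sq_dvd_geom_sum₂_sub (R := ℤ) (a := 1) (b := m) hodd
    have hk' : k = 1 + p * m := by linarith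
    simp only [one_pow, mul_one, ← hk'] at hc
    refine ⟨1 + p * c, by linear_combination hc, fun h => ?_⟩
    have h1 : (p : ℤ) ∣ 1 := (Int.dvd_add_left (dvd_mul_right _ c)).1 h
    exact (Nat.prime_iff_prime_int.1 hp).not_isUnit (isUnit_of_dvd_one h1)

theorem conj_pow_eq_zpow {G : Type*} [Group G] {a x : G} {k : ℤ} (h : x * a * x⁻¹ = a ^ k)
    (t : ℕ) (i : ℤ) : x ^ t * a ^ i * (x ^ t)⁻¹ = a ^ (i * k ^ t) := by
  induction t generalizing i with
  | zero => simp
  | succ t ih =>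
    have h1 : x * a ^ i * x⁻¹ = a ^ (i * k) := by
      rw [← conj_zpow, h, ← zpow_mul, mul_comm]
    calc x ^ (t + 1) * a ^ i * (x ^ (t + 1))⁻¹
        = x ^ t * (x * a ^ i * x⁻¹) * (x ^ t)⁻¹ := by rw [pow_succ]; group
      _ = a ^ (i * k ^ (t + 1)) := by rw [h1, ih, pow_succ]; ring_nf

theorem zpow_mul_pow_eq {G : Type*} [Group G] {a x : G} {k : ℤ} (h : x * a * x⁻¹ = a ^ k)
    (i : ℤ) (m : ℕ) :
    (a ^ i * x) ^ m = a ^ (i * ∑ t ∈ Finset.range m, k ^ t) * x ^ m := by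
  induction m with
  | zero => simp
  | succ m ih =>
    rw [pow_succ, ih, Finset.sum_range_succ, mul_add, zpow_add, ← conj_pow_eq_zpow h, pow_succ]
    group

/-- For `p` prime: `G` has at most one subgroup of order `p`. -/
def AtMostOneSubgroupOfOrder (p : ℕ) (G : Type*) [Group G] : Prop :=
  ∀ x y : G, x ^ p = 1 → y ^ p = 1 → x ≠ 1 → y ∈ Subgroup.zpowers x

theorem AtMostOneSubgroupOfOrder.mem_zpowers {p : ℕ} [hp : Fact p.Prime] {G : Type*}
    [Group G] [Finite G] (hG : IsPGroup p G) (hu : AtMostOneSubgroupOfOrder p G) {a y : G}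
    (ha : a ≠ 1) (hy : y ^ p = 1) : y ∈ Subgroup.zpowers a := by
  have ho : orderOf (a ^ (orderOf a / p)) = p :=
    orderOf_pow_orderOf_div (orderOf_pos a).ne' (hG.dvd_orderOf ha)
  have h1 : a ^ (orderOf a / p) ≠ 1 := by
    rw [Ne, ← orderOf_eq_one_iff, ho]
    exact hp.out.one_lt.ne'
  have h2 := hu _ y (by nth_rw 2 [← ho]; exact pow_orderOf_eq_one _) hy h1
  exact (Subgroup.zpowers_le.2 (Subgroup.npow_mem_zpowers a _)) h2

/-- An element outside a self-centralizing normal cyclic subgroup `⟨a⟩` whose `p`-th power lies in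
`⟨a⟩` forces `p = 2` and inverts `a`. -/
theorem AtMostOneSubgroupOfOrder.conj_eq_inv {p : ℕ} [hp : Fact p.Prime] {G : Type*}
    [Group G] [Finite G] (hG : IsPGroup p G) (hu : AtMostOneSubgroupOfOrder p G) {a x : G}
    (ha : a ≠ 1) (hcent : ∀ g, Commute g a → g ∈ Subgroup.zpowers a)
    (hx : x ∉ Subgroup.zpowers a) (hxp : x ^ p ∈ Subgroup.zpowers a) {k : ℤ}
    (hk : x * a * x⁻¹ = a ^ k) :
    p = 2 ∧ 4 ∣ orderOf a ∧ x * a * x⁻¹ = a⁻¹ ∧ x ^ 2 = a ^ (orderOf a / 2) := by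
  obtain ⟨n, hn⟩ := IsPGroup.iff_orderOf.1 hG a
  obtain ⟨j, hj : a ^ j = x ^ p⟩ := hxp
  have hpI : Prime (p : ℤ) := Nat.prime_iff_prime_int.1 hp.out
  have hn0 : n ≠ 0 := by
    rintro rfl
    exact ha (orderOf_eq_one_iff.1 (by simpa using hn))
  have hpN : (p : ℤ) ∣ (orderOf a : ℤ) := by
    exact_mod_cast hG.dvd_orderOf ha
  have hk1 : ¬ (orderOf a : ℤ) ∣ k - 1 := by
    intro h
    have : a ^ k = a ^ (1 : ℤ) := zpow_eq_zpow_iff_modEq.2 (Int.modEq_iff_dvd.2 h).symm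
    rw [this, zpow_one, mul_inv_eq_iff_eq_mul] at hk
    exact hx (hcent x hk)
  have hpj : (p : ℤ) ∣ j := by
    by_contra h
    obtain ⟨s, hs : (a ^ j) ^ s = a⟩ := hG.mem_zpowers_zpow hp.out a h
    refine hx (hcent x ?_)
    rw [← hs, hj]
    exact ((Commute.refl x).pow_right p).zpow_right s
  have hkp : (orderOf a : ℤ) ∣ k ^ p - 1 := by
    have h1 := conj_pow_eq_zpow hk p 1
    rw [← hj, one_mul] at h1
    have h2 : a ^ (k ^ p) = a ^ (1 : ℤ) := by rw [← h1]; group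
    exact (Int.modEq_iff_dvd.1 (zpow_eq_zpow_iff_modEq.1 h2).symm)
  have hkmod : (p : ℤ) ∣ k - 1 := by
    have h1 := hpN.trans hkp
    rw [← ZMod.intCast_zmod_eq_zero_iff_dvd] at h1 ⊢
    simpa using h1
  have hno : ∀ i : ℤ, ¬ (orderOf a : ℤ) ∣ i * ∑ t ∈ Finset.range p, k ^ t + j := by
    intro i hi
    have h1 : (a ^ i * x) ^ p = 1 := by
      rw [zpow_mul_pow_eq hk, ← hj, ← zpow_add]
      exact orderOf_dvd_iff_zpow_eq_one.1 hi
    have h2 := hu.mem_zpowers hG ha h1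
    exact hx ((Subgroup.mul_mem_cancel_left _ (Subgroup.zpow_mem_zpowers a i)).1 h2)
  have h24 : p = 2 ∧ ¬ (4 : ℤ) ∣ k - 1 := by
    by_contra! h
    obtain ⟨u, hS, hu⟩ := Int.exists_geom_sum_eq_mul hp.out hkmod h
    obtain ⟨v, rfl⟩ := hpj
    obtain ⟨i, hi⟩ := hp.out.exists_pow_dvd_mul_add (n := n) (v := v) hu
    exact hno i (by rwa [hS, hn])
  obtain ⟨rfl, h4⟩ := h24
  have hkj : (orderOf a : ℤ) ∣ j * (k - 1) := by
    have h1 : x * a ^ j * x⁻¹ = a ^ j := by rw [hj]; group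
    have h2 := conj_pow_eq_zpow hk 1 j
    rw [pow_one, pow_one, h1] at h2
    have := Int.modEq_iff_dvd.1 (zpow_eq_zpow_iff_modEq.1 h2)
    rwa [show j * (k - 1) = j * k - j by ring]
  obtain ⟨m, hm⟩ := hkmod
  have hmodd : ¬ (2 : ℤ) ∣ m := by push_cast at hm; omega
  have hco : IsCoprime (orderOf a : ℤ) m := by
    rw [hn, Nat.cast_pow]
    exact (hpI.coprime_iff_not_dvd.2 hmodd).pow_left
  obtain ⟨c, hc⟩ : (orderOf a : ℤ) ∣ 2 * (k + 1) := by
    refine hco.dvd_of_dvd_mul_right ?_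
    rwa [show 2 * (k + 1) * m = k ^ 2 - 1 by push_cast at hm; linear_combination (-(k + 1)) * hm]
  obtain ⟨d, hd⟩ : (orderOf a : ℤ) ∣ 2 * j := by
    refine hco.dvd_of_dvd_mul_right ?_
    rwa [show 2 * j * m = j * (k - 1) by push_cast at hm; linear_combination (-j) * hm]
  have hd1 : d % 2 = 1 := by
    by_contra h
    obtain ⟨e, rfl⟩ : (2 : ℤ) ∣ d := by omega
    exact hno 0 ⟨e, by linarith⟩
  have hc0 : (2 : ℤ) ∣ c := by
    by_contra h
    obtain ⟨e, he⟩ : (2 : ℤ) ∣ c + d := by omega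
    refine hno 1 ⟨e, ?_⟩
    simp only [Finset.sum_range_succ, Finset.sum_range_zero]
    have hcd := congrArg ((orderOf a : ℤ) * ·) he
    simp only [mul_add] at hcd
    linarith
  obtain ⟨c, rfl⟩ := hc0
  have hinv : x * a * x⁻¹ = a⁻¹ := by
    rw [hk, ← zpow_neg_one, zpow_eq_zpow_iff_modEq]
    exact (Int.modEq_iff_dvd.2 ⟨c, by linarith⟩).symm
  have hN4 : 4 ∣ orderOf a := by
    rcases n with _ | _ | n
    · exact absurd rfl hn0
    · exact absurd (by rw [hn, hm]; simp) hk1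
    · rw [hn]; exact ⟨2 ^ n, by ring⟩
  refine ⟨rfl, hN4, hinv, ?_⟩
  rw [← hj, ← zpow_natCast, zpow_eq_zpow_iff_modEq, Int.modEq_iff_dvd]
  obtain ⟨M, hM⟩ := (Nat.dvd_trans (by norm_num) hN4 : 2 ∣ orderOf a)
  refine ⟨-(d / 2), ?_⟩
  obtain ⟨e, rfl⟩ : ∃ e, d = 2 * e + 1 := ⟨d / 2, by omega⟩
  rw [show (2 * e + 1) / 2 = e by omega]
  rw [hM] at hd ⊢
  rw [Nat.mul_div_cancel_left _ two_pos]
  push_cast at hd ⊢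
  linarith

/-- In a finite `p`-group with at most one subgroup of order `p`, some nontrivial normal cyclic
subgroup contains its own centralizer. -/
theorem AtMostOneSubgroupOfOrder.exists_normal_self_centralizing {p : ℕ} [hp : Fact p.Prime]
    {G : Type*} [Group G] [Finite G] [Nontrivial G] (hG : IsPGroup p G)
    (hu : AtMostOneSubgroupOfOrder p G) :
    ∃ a : G, a ≠ 1 ∧ (Subgroup.zpowers a).Normal ∧
      ∀ g, Commute g a → g ∈ Subgroup.zpowers a := by
  have hfin : {a : G | (Subgroup.zpowers a).Normal}.Finite := Set.toFinite _
  obtain ⟨a, ha, hmax⟩ := hfin.exists_maximalFor orderOf _ ⟨1, by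
    simp only [Set.mem_ofPred_eq, Subgroup.zpowers_one_eq_bot]; infer_instance⟩
  have hmax' : ∀ b : G, (Subgroup.zpowers b).Normal → orderOf b ≤ orderOf a := fun b hb =>
    (le_total (orderOf b) (orderOf a)).elim id fun h => hmax hb h
  have ha : (Subgroup.zpowers a).Normal := ha
  have ha1 : a ≠ 1 := by
    rintro rfl
    obtain ⟨z, -, hz, hzo⟩ := hG.exists_mem_center_orderOf_eq ⊤ top_ne_bot
    have h := hmax' z ⟨fun b hb g => by
      have hbc := (Subgroup.zpowers_le.2 hz) hb
      rwa [Subgroup.mem_center_iff.1 hbc g, mul_inv_cancel_right]⟩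
    rw [hzo, orderOf_one] at h
    exact absurd hp.out.one_lt h.not_gt
  refine ⟨a, ha1, ha, ?_⟩
  by_contra! ⟨y, hya, hy⟩
  let C : Subgroup G := Subgroup.centralizer (Subgroup.zpowers a : Set G)
  let π := QuotientGroup.mk' (Subgroup.zpowers a)
  have : C.Normal := Subgroup.normal_centralizer
  have hN : (C.map π).Normal := Subgroup.Normal.map this π (QuotientGroup.mk'_surjective _)
  have hyC : y ∈ C := by
    rw [Subgroup.mem_centralizer_iff]
    rintro _ ⟨i, rfl⟩
    exact (hya.zpow_right i).symm
  obtain ⟨q, ⟨g, hgC, rfl⟩, hgc, hgo⟩ :=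
    (hG.to_quotient (Subgroup.zpowers a)).exists_mem_center_orderOf_eq (C.map π) (by
      intro h
      have h1 : π y ∈ C.map π := ⟨y, hyC, rfl⟩
      rw [h, Subgroup.mem_bot] at h1
      exact hy ((QuotientGroup.eq_one_iff y).1 h1))
  have hga : Commute g a := (Subgroup.mem_centralizer_iff.1 hgC a (Subgroup.mem_zpowers a)).symm
  have hgA : g ∉ Subgroup.zpowers a := by
    intro h
    have h1 : π g = 1 := (QuotientGroup.eq_one_iff g).2 h
    rw [h1, orderOf_one] at hgo
    exact hp.out.one_lt.ne hgo
  obtain ⟨j, hj : a ^ j = g ^ p⟩ : g ^ p ∈ Subgroup.zpowers a := by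
    refine (QuotientGroup.eq_one_iff (g ^ p)).1 ?_
    have h := pow_orderOf_eq_one (π g)
    rwa [hgo, ← map_pow] at h
  have hpj : ¬ (p : ℤ) ∣ j := by
    rintro ⟨v, rfl⟩
    have h1 : (a ^ (-v) * g) ^ p = 1 := by
      rw [((hga.zpow_right (-v)).symm).mul_pow, ← hj, ← zpow_natCast, ← zpow_mul, ← zpow_add]
      simp [mul_comm]
    have h2 := hu.mem_zpowers hG ha1 h1
    exact hgA ((Subgroup.mul_mem_cancel_left _ (Subgroup.zpow_mem_zpowers a _)).1 h2)
  have hag : Subgroup.zpowers a ≤ Subgroup.zpowers g := by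
    have h := hG.mem_zpowers_zpow hp.out a hpj
    rw [hj] at h
    exact Subgroup.zpowers_le.2 (Subgroup.zpowers_le.2 (Subgroup.npow_mem_zpowers g p) h)
  have hgn : (Subgroup.zpowers g).Normal := by
    refine ⟨fun b hb h => ?_⟩
    obtain ⟨i, rfl⟩ := hb
    change h * g ^ i * h⁻¹ ∈ _
    rw [← conj_zpow]
    refine Subgroup.zpow_mem _ ?_ i
    have h1 : π (g⁻¹ * (h * g * h⁻¹)) = 1 := by
      have h2 := Subgroup.mem_center_iff.1 hgc (π h)
      simp only [map_mul, map_inv, h2]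
      group
    have h3 := hag ((QuotientGroup.eq_one_iff _).1 h1)
    exact (Subgroup.mul_mem_cancel_left _ (Subgroup.inv_mem _ (Subgroup.mem_zpowers g))).1 h3
  have hlt : Subgroup.zpowers a < Subgroup.zpowers g :=
    lt_of_le_of_ne hag fun h => hgA (h ▸ Subgroup.mem_zpowers g)
  have h1 : (Subgroup.zpowers g : Set G).ncard ≤ (Subgroup.zpowers a : Set G).ncard := by
    have := hmax' g hgn
    rwa [← Nat.card_zpowers, ← Nat.card_zpowers] at this
  exact h1.not_gt (Set.ncard_lt_ncard hlt (Set.toFinite _))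

/-- The homomorphism `i ↦ a ^ i` on `ZMod n`, for an element `a` of order `n`. -/
theorem exists_zmod_hom_of_orderOf_eq {G : Type*} [Group G] {a : G} {n : ℕ}
    (ha : orderOf a = n) :
    ∃ f : Multiplicative (ZMod n) →* G, Function.Injective f ∧
      ∀ i : ℤ, f (Multiplicative.ofAdd (i : ZMod n)) = a ^ i := by
  subst ha
  let φ := ZMod.lift (orderOf a) ⟨zmultiplesHom (Additive G) (Additive.ofMul a), by
    rw [zmultiplesHom_apply, natCast_zsmul, ← ofMul_pow, pow_orderOf_eq_one, ofMul_one]⟩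
  have hφ : ∀ i : ℤ, φ i = Additive.ofMul (a ^ i) := fun i => by
    rw [ZMod.lift_coe]; simp
  refine ⟨AddMonoidHom.toMultiplicativeLeft φ, ?_, hφ⟩
  have : Function.Injective φ := by
    rw [ZMod.lift_injective]
    intro m hm
    rw [ZMod.intCast_zmod_eq_zero_iff_dvd, orderOf_dvd_iff_zpow_eq_one]
    exact hm
  exact this

/-- A group generated by a cyclic subgroup `⟨a⟩` of order `2 * n` and index two and an element `x`
inverting `a` with `x ^ 2 = a ^ n` is dicyclic. -/
theorem QuaternionGroup.nonempty_mulEquiv {G : Type*} [Group G] {a x : G} {n : ℕ}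
    (ho : orderOf a = 2 * n) (hx : x ∉ Subgroup.zpowers a) (hinv : x * a * x⁻¹ = a⁻¹)
    (hsq : x ^ 2 = a ^ n) (hcov : ∀ g, g ∉ Subgroup.zpowers a → x⁻¹ * g ∈ Subgroup.zpowers a) :
    Nonempty (G ≃* QuaternionGroup n) := by
  obtain ⟨f, hf, hfa⟩ := exists_zmod_hom_of_orderOf_eq ho
  let e : ZMod (2 * n) → G := fun i => f (Multiplicative.ofAdd i)
  have he : ∀ i : ℤ, e i = a ^ i := hfa
  have hadd : ∀ i j, e (i + j) = e i * e j := fun i j => f.map_mul _ _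
  have hsub : ∀ i j, e (i - j) = e i * (e j)⁻¹ := fun i j =>
    (f.map_div _ _).trans (div_eq_mul_inv _ _)
  have hinj : Function.Injective e := hf
  have hmem : ∀ i, e i ∈ Subgroup.zpowers a := fun i => by
    obtain ⟨k, rfl⟩ := ZMod.intCast_surjective i
    exact ⟨k, (he k).symm⟩
  have hcomm : ∀ i, e i * x = x * (e i)⁻¹ := fun i => by
    obtain ⟨k, rfl⟩ := ZMod.intCast_surjective i
    have h1 : x * a ^ (-k) * x⁻¹ = a ^ k := by
      rw [← conj_zpow, hinv, inv_zpow, zpow_neg, inv_inv]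
    rw [he, ← zpow_neg]
    exact (mul_inv_eq_iff_eq_mul.1 h1).symm
  have hsq' : x * x = e (n : ZMod (2 * n)) := by
    have h := he (n : ℤ)
    rw [Int.cast_natCast, zpow_natCast, ← hsq, sq] at h
    exact h.symm
  have hee : ∀ i j, Commute (e i)⁻¹ (e j) := fun i j =>
    Commute.inv_left (show e i * e j = e j * e i by rw [← hadd, add_comm, hadd])
  let F : QuaternionGroup n →* G := MonoidHom.mk' (fun q => match q with
    | .a i => e i
    | .xa i => x * e i) (by
      rintro (i | i) (j | j)
      · exact hadd i j
      · change x * e (j - i) = e i * (x * e j)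
        rw [← mul_assoc, hcomm, hsub, mul_assoc, (hee i j).eq]
      · change x * e (i + j) = x * e i * e j
        rw [hadd, mul_assoc]
      · change e (n + j - i) = x * e i * (x * e j)
        rw [hsub, hadd, ← hsq', mul_assoc x (e i), ← mul_assoc (e i), hcomm, mul_assoc x (e i)⁻¹,
          (hee i j).eq]
        simp only [mul_assoc])
  refine ⟨(MulEquiv.ofBijective F ⟨?_, ?_⟩).symm⟩
  · rintro (i | i) (j | j) h
    · exact congrArg _ (hinj h)
    · have h : e i = x * e j := h
      exact absurd ((Subgroup.mul_mem_cancel_right _ (hmem j)).1 (h ▸ hmem i)) hx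
    · have h : x * e i = e j := h
      exact absurd ((Subgroup.mul_mem_cancel_right _ (hmem i)).1 (h ▸ hmem j)) hx
    · exact congrArg _ (hinj (mul_left_cancel h))
  · intro g
    by_cases hg : g ∈ Subgroup.zpowers a
    · obtain ⟨k, rfl⟩ := hg
      exact ⟨.a k, he k⟩
    · obtain ⟨k, hk : a ^ k = x⁻¹ * g⟩ := hcov g hg
      exact ⟨.xa k, show x * e k = g by rw [he, hk, mul_inv_cancel_left]⟩

/-- A finite `p`-group with at most one subgroup of order `p` is cyclic or generalized
quaternion. -/
theorem AtMostOneSubgroupOfOrder.isCyclic_or_isGeneralizedQuaternion {p : ℕ} [hp : Fact p.Prime]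
    {G : Type*} [Group G] [Finite G] (hG : IsPGroup p G) (hu : AtMostOneSubgroupOfOrder p G) :
    IsCyclic G ∨ (p = 2 ∧ IsGeneralizedQuaternion G) := by
  rcases subsingleton_or_nontrivial G with _ | _
  · exact Or.inl inferInstance
  obtain ⟨a, ha1, ha, hcent⟩ := hu.exists_normal_self_centralizing hG
  by_cases htop : Subgroup.zpowers a = ⊤
  · exact Or.inl ⟨a, (Subgroup.eq_top_iff' _).1 htop⟩
  have key : ∀ x, x ∉ Subgroup.zpowers a → x ^ p ∈ Subgroup.zpowers a →
      p = 2 ∧ 4 ∣ orderOf a ∧ x * a * x⁻¹ = a⁻¹ ∧ x ^ 2 = a ^ (orderOf a / 2) := by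
    intro x hx hxp
    obtain ⟨k, hk⟩ := ha.conj_mem a (Subgroup.mem_zpowers a) x
    exact hu.conj_eq_inv hG ha1 hcent hx hxp hk.symm
  have hroot : ∀ y, y ∉ Subgroup.zpowers a → ∃ t : ℕ, y ^ p ^ t ∉ Subgroup.zpowers a ∧
      (y ^ p ^ t) ^ p ∈ Subgroup.zpowers a := by
    intro y hy
    have hex : ∃ t : ℕ, y ^ p ^ t ∈ Subgroup.zpowers a := by
      obtain ⟨t, ht⟩ := hG.exists_pow_pow_eq_one y
      exact ⟨t, ht ▸ Subgroup.one_mem _⟩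
    classical
    obtain ⟨t, ht⟩ : ∃ t, Nat.find hex = t + 1 := by
      refine Nat.exists_eq_succ_of_ne_zero fun h0 => hy ?_
      simpa [h0] using Nat.find_spec hex
    refine ⟨t, Nat.find_min hex (by omega), ?_⟩
    rw [← pow_mul, ← pow_succ, ← ht]
    exact Nat.find_spec hex
  obtain ⟨y₀, hy₀⟩ : ∃ y, y ∉ Subgroup.zpowers a := by
    by_contra! h
    exact htop (eq_top_iff.2 fun g _ => h g)
  obtain ⟨rfl, h4⟩ : p = 2 ∧ 4 ∣ orderOf a := by
    obtain ⟨t, ht, htp⟩ := hroot y₀ hy₀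
    exact ⟨(key _ ht htp).1, (key _ ht htp).2.1⟩
  -- `-1` is not a square modulo `4`, so every element outside `⟨a⟩` inverts `a`
  have hall : ∀ y, y ∉ Subgroup.zpowers a → y * a * y⁻¹ = a⁻¹ ∧ y ^ 2 = a ^ (orderOf a / 2) := by
    intro y hy
    obtain ⟨t, ht, htp⟩ := hroot y hy
    rcases t with _ | t
    · simp only [pow_zero, pow_one] at ht htp
      exact (key y ht htp).2.2
    · exfalso
      have h1 := (key _ ht htp).2.2.1
      obtain ⟨k, hk : a ^ k = y ^ 2 ^ t * a * (y ^ 2 ^ t)⁻¹⟩ :=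
        ha.conj_mem a (Subgroup.mem_zpowers a) (y ^ 2 ^ t)
      have h2 := conj_pow_eq_zpow hk.symm 2 1
      rw [← pow_mul, ← pow_succ, zpow_one, h1, ← zpow_neg_one, zpow_eq_zpow_iff_modEq,
        Int.modEq_iff_dvd, one_mul] at h2
      have h3 : (4 : ℤ) ∣ k ^ 2 - -1 := (by exact_mod_cast h4 : (4 : ℤ) ∣ orderOf a).trans h2
      rcases Int.even_or_odd' k with ⟨m, rfl | rfl⟩ <;> ring_nf at h3 <;> omega
  refine Or.inr ⟨rfl, ?_⟩
  obtain ⟨n, hn⟩ := IsPGroup.iff_orderOf.1 hG a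
  have hn2 : 2 ≤ n := by
    rw [hn] at h4
    exact (Nat.pow_dvd_pow_iff_le_right (x := 2) (by norm_num)).1 h4
  obtain ⟨n, rfl⟩ := Nat.exists_eq_add_of_le' hn2
  refine ⟨n + 3, by omega, ?_⟩
  obtain ⟨hxinv, hxsq⟩ := hall y₀ hy₀
  have ho : orderOf a = 2 * 2 ^ (n + 3 - 2) := by
    rw [hn, ← pow_succ']; congr 1
  refine QuaternionGroup.nonempty_mulEquiv ho hy₀ hxinv ?_ fun g hg => hcent _ ?_
  · rw [hxsq, ho, Nat.mul_div_cancel_left _ two_pos]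
  · have h1 := (hall g hg).1
    rw [← hxinv, mul_inv_eq_iff_eq_mul] at h1
    change y₀⁻¹ * g * a = a * (y₀⁻¹ * g)
    rw [mul_assoc, h1]
    group

theorem IsPGroup.exists_subgroup_mulEquiv_zmod_prod_zmod {p : ℕ} [hp : Fact p.Prime]
    {G : Type*} [Group G] (hG : IsPGroup p G) {z w : G} (hz : orderOf z = p) (hw : orderOf w = p)
    (hzw : Commute z w) (hmem : w ∉ Subgroup.zpowers z) :
    ∃ S : Subgroup G, Nonempty (S ≃* Multiplicative (ZMod p × ZMod p)) := by
  obtain ⟨f, hf, hfz⟩ := exists_zmod_hom_of_orderOf_eq hz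
  obtain ⟨g, hg, hgw⟩ := exists_zmod_hom_of_orderOf_eq hw
  have hfz' : ∀ i, ∃ k : ℤ, f i = z ^ k := fun i => by
    obtain ⟨k, hk⟩ := ZMod.intCast_surjective i.toAdd
    exact ⟨k, by rw [← hfz, hk, ofAdd_toAdd]⟩
  have hgw' : ∀ i, ∃ k : ℤ, g i = w ^ k := fun i => by
    obtain ⟨k, hk⟩ := ZMod.intCast_surjective i.toAdd
    exact ⟨k, by rw [← hgw, hk, ofAdd_toAdd]⟩
  have hcomm : ∀ i j, Commute (f i) (g j) := fun i j => by
    obtain ⟨k, hk⟩ := hfz' i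
    obtain ⟨l, hl⟩ := hgw' j
    rw [hk, hl]
    exact (hzw.zpow_left k).zpow_right l
  let F : Multiplicative (ZMod p × ZMod p) →* G :=
    (f.noncommCoprod g hcomm).comp (MulEquiv.prodMultiplicative (ZMod p) (ZMod p)).toMonoidHom
  have hF : Function.Injective F := by
    refine Function.Injective.comp (g := f.noncommCoprod g hcomm) ?_
      (MulEquiv.prodMultiplicative (ZMod p) (ZMod p)).injective
    refine (MonoidHom.noncommCoprod_injective f g hcomm).2 ⟨hf, hg, Subgroup.disjoint_def.2 ?_⟩
    rintro _ ⟨i, rfl⟩ ⟨j, hj⟩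
    obtain ⟨k, hk⟩ := hfz' i
    obtain ⟨l, hl⟩ := hgw' j
    rw [← hj, hl, ← orderOf_dvd_iff_zpow_eq_one, hw]
    by_contra hpl
    refine hmem (Subgroup.zpowers_le.2 ?_ (hG.mem_zpowers_zpow hp.out w hpl))
    exact ⟨k, hk.symm.trans (hj.symm.trans hl)⟩
  exact ⟨F.range, ⟨(MonoidHom.ofInjective hF).symm⟩⟩

theorem IsPGroup.atMostOneSubgroupOfOrder {p : ℕ} [hp : Fact p.Prime] {G : Type*}
    [Group G] [Finite G] (hG : IsPGroup p G)
    (h : ∀ S : Subgroup G, IsEmpty (S ≃* Multiplicative (ZMod p × ZMod p))) :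
    AtMostOneSubgroupOfOrder p G := by
  intro x y hx hy hx1
  have : Nontrivial G := ⟨x, 1, hx1⟩
  obtain ⟨z, -, hz, hzo⟩ := hG.exists_mem_center_orderOf_eq ⊤ top_ne_bot
  have key : ∀ w : G, w ^ p = 1 → w ∈ Subgroup.zpowers z := by
    intro w hw
    by_contra hwz
    have hw1 : w ≠ 1 := fun h => hwz (h ▸ Subgroup.one_mem _)
    obtain ⟨S, ⟨e⟩⟩ := hG.exists_subgroup_mulEquiv_zmod_prod_zmod hzo (orderOf_eq_prime hw hw1)
      (Subgroup.mem_center_iff.1 hz w).symm hwz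
    exact (h S).false e
  obtain ⟨k, rfl⟩ := key x hx
  obtain ⟨l, rfl⟩ := key y hy
  have hk : ¬ (p : ℤ) ∣ k := fun hd => hx1 (by
    rw [← hzo] at hd
    exact orderOf_dvd_iff_zpow_eq_one.1 hd)
  exact Subgroup.zpow_mem _ (hG.mem_zpowers_zpow hp.out z hk) l

theorem IsSection.not_isCyclic_sylow {p : ℕ} [hp : Fact p.Prime] {Γ : Type*} [Group Γ] [Finite Γ]
    (h : IsSection (Multiplicative (ZMod p × ZMod p)) Γ) (Q : Sylow p Γ) : ¬ IsCyclic Q := by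
  intro hQ
  obtain ⟨H, f, hf⟩ := h
  obtain ⟨P⟩ : Nonempty (Sylow p H) := inferInstance
  have hΔ : IsPGroup p (Multiplicative (ZMod p × ZMod p)) :=
    IsPGroup.of_card (n := 2) (by simp [sq])
  have htop : (P : Subgroup H).map f = ⊤ :=
    ((P.mapSurjective hf).is_maximal' (hΔ.to_subgroup ⊤) le_top).symm
  obtain ⟨R, hR⟩ := (P.2.map H.subtype).exists_le_sylow
  have hRc : IsCyclic R := isCyclic_of_surjective (Sylow.equiv Q R) (Sylow.equiv Q R).surjective
  have hPc : IsCyclic P := by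
    refine isCyclic_of_injective ((Subgroup.inclusion hR).comp ((H.subtype).subgroupMap P)) ?_
    intro x y hxy
    have h : ((x : H) : Γ) = ((y : H) : Γ) := congrArg (Subtype.val : R → Γ) hxy
    exact Subtype.ext (Subtype.ext h)
  have hcyc : IsCyclic (Multiplicative (ZMod p × ZMod p)) := by
    refine isCyclic_of_surjective (f.comp (P : Subgroup H).subtype) fun d => ?_
    obtain ⟨q, hq, rfl⟩ := (htop ▸ Subgroup.mem_top d : d ∈ (P : Subgroup H).map f)
    exact ⟨⟨q, hq⟩, rfl⟩
  rw [isCyclic_multiplicative_iff] at hcyc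
  have := coprime_card_of_isAddCyclic_prod (ZMod p) (ZMod p)
  rw [Nat.card_zmod, Nat.coprime_self] at this
  exact hp.out.one_lt.ne' this

theorem stmt6 (p : ℕ) (hp : p.Prime) (Γ : Type*) [Group Γ] [Fintype Γ]
    (hsec : IsSection (Multiplicative (ZMod p × ZMod p)) Γ) :
    (∃ S : Subgroup Γ, Nonempty (S ≃* Multiplicative (ZMod p × ZMod p))) ∨
      (p = 2 ∧ ∀ Q : Sylow 2 Γ, IsGeneralizedQuaternion Q) := by
  have : Fact p.Prime := ⟨hp⟩
  by_cases h : ∃ S : Subgroup Γ, Nonempty (S ≃* Multiplicative (ZMod p × ZMod p))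
  · exact Or.inl h
  have hQ : ∀ Q : Sylow p Γ, p = 2 ∧ IsGeneralizedQuaternion Q := by
    intro Q
    have hu : AtMostOneSubgroupOfOrder p Q :=
      IsPGroup.atMostOneSubgroupOfOrder Q.2 fun S => ⟨fun e =>
        h ⟨S.map (Q : Subgroup Γ).subtype,
          ⟨(S.equivMapOfInjective _ (Subgroup.subtype_injective _)).symm.trans e⟩⟩⟩
    exact (hu.isCyclic_or_isGeneralizedQuaternion Q.2).resolve_left (hsec.not_isCyclic_sylow Q)
  obtain ⟨Q⟩ : Nonempty (Sylow p Γ) := inferInstance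
  obtain rfl := (hQ Q).1
  exact Or.inr ⟨rfl, fun Q => (hQ Q).2⟩
end

section
/- Let p be a prime and let P be a nontrivial finite p-group in which every abelian subgroup is cyclic. Then P is cyclic, or p = 2 and P is a generalized quaternion group. -/
theorem commute_pair_isCyclic {G : Type*} [Group G]
    (hcyc : ∀ H : Subgroup G, (∀ a b : H, a * b = b * a) → IsCyclic H) {u w : G}
    (huw : Commute u w) : IsCyclic (Subgroup.closure {u, w}) := by
  apply hcyc
  have hcomm : ∀ s ∈ ({u, w} : Set G), ∀ t ∈ ({u, w} : Set G), s * t = t * s := by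
    rintro s (rfl | rfl) t (rfl | rfl)
    exacts [rfl, huw, huw.symm, rfl]
  exact (Subgroup.isMulCommutative_closure hcomm).is_comm.comm

theorem mem_zpowers_of_commute_of_pow_prime_eq_one {G : Type*} [Group G] [Finite G] {p : ℕ}
    (hp : p.Prime) (hcyc : ∀ H : Subgroup G, (∀ a b : H, a * b = b * a) → IsCyclic H) {u w : G}
    (huw : Commute u w) (hu : u ^ p = 1) (hw : orderOf w = p) : u ∈ Subgroup.zpowers w := by
  classical
  have : Fintype G := Fintype.ofFinite G
  have hC := commute_pair_isCyclic hcyc huw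
  set H := Subgroup.closure {u, w} with hH
  have huH : u ∈ H := Subgroup.subset_closure (by simp)
  have hwH : w ∈ H := Subgroup.subset_closure (by simp)
  have hle := IsCyclic.card_pow_eq_one_le (α := H) hp.pos
  set w' : H := ⟨w, hwH⟩
  have hw' : orderOf w' = p := by rw [← hw]; exact Subgroup.orderOf_mk w hwH
  have hsub : (Subgroup.zpowers w' : Set H).toFinset ⊆
      Finset.univ.filter fun y : H => y ^ p = 1 := by
    intro y hy
    obtain ⟨k, rfl⟩ := Set.mem_toFinset.1 hy
    simp only [Finset.mem_filter, Finset.mem_univ, true_and]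
    rw [← zpow_natCast, ← zpow_mul, mul_comm, zpow_mul, zpow_natCast, ← hw', pow_orderOf_eq_one,
      one_zpow]
  have hcard : (Subgroup.zpowers w' : Set H).toFinset.card = p := by
    rw [Set.toFinset_card, ← hw']
    exact Fintype.card_zpowers
  have heq := Finset.eq_of_subset_of_card_le hsub (by rw [hcard]; exact hle)
  have hmem : (⟨u, huH⟩ : H) ∈ (Subgroup.zpowers w' : Set H).toFinset := by
    rw [heq]
    simp only [Finset.mem_filter, Finset.mem_univ, true_and]
    exact Subtype.ext hu
  obtain ⟨k, hk⟩ := Set.mem_toFinset.1 hmem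
  exact ⟨k, congrArg Subtype.val hk⟩

theorem mem_zpowers_of_pow_prime_eq_one {G : Type*} [Group G] [Finite G] {p : ℕ}
    (hp : p.Prime) (hG : IsPGroup p G)
    (hcyc : ∀ H : Subgroup G, (∀ a b : H, a * b = b * a) → IsCyclic H) {a y : G}
    (ha : a ≠ 1) (hy : y ^ p = 1) : y ∈ Subgroup.zpowers a := by
  have : Fact p.Prime := ⟨hp⟩
  have : Nontrivial G := ⟨a, 1, ha⟩
  have hprime : ∀ {H : Type _} [Group H] (_ : IsPGroup p H) (g : H), g ≠ 1 →
      ∃ k : ℕ, orderOf (g ^ k) = p := by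
    intro H _ hH g hg
    obtain ⟨n, hn⟩ := IsPGroup.iff_orderOf.1 hH g
    have hn0 : n ≠ 0 := by
      rintro rfl
      exact hg (orderOf_eq_one_iff.1 (by simpa using hn))
    obtain ⟨n, rfl⟩ := Nat.exists_eq_succ_of_ne_zero hn0
    refine ⟨p ^ n, ?_⟩
    rw [orderOf_pow_of_dvd (pow_pos hp.pos n).ne' (hn ▸ pow_dvd_pow p n.le_succ), hn,
      Nat.pow_div n.le_succ hp.pos]
    simp
  obtain ⟨z, hz⟩ := (have := hG.center_nontrivial; exists_ne (1 : Subgroup.center G))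
  obtain ⟨k, hk⟩ := hprime hG z (fun h => hz (Subtype.ext h))
  obtain ⟨l, hl⟩ := hprime hG a ha
  have hcent : ∀ g : G, Commute g ((z : G) ^ k) := fun g =>
    Commute.pow_right (Subgroup.mem_center_iff.1 z.2 g) k
  have hyz := mem_zpowers_of_commute_of_pow_prime_eq_one hp hcyc (hcent y) hy hk
  have hza := mem_zpowers_of_commute_of_pow_prime_eq_one hp hcyc (hcent (a ^ l)).symm
    (by rw [← hk, pow_orderOf_eq_one]) hl
  exact Subgroup.zpowers_le.2 (Subgroup.pow_mem _ (Subgroup.mem_zpowers a) l)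
    (Subgroup.zpowers_le.2 hza hyz)

theorem exists_self_centralizing_cyclic_normal {G : Type*} [Group G] [Finite G]
    [Group.IsNilpotent G]
    (hcyc : ∀ H : Subgroup G, (∀ a b : H, a * b = b * a) → IsCyclic H) :
    ∃ a : G, (Subgroup.zpowers a).Normal ∧ ∀ c, Commute c a → c ∈ Subgroup.zpowers a := by
  obtain ⟨a, haN, hmax⟩ := Set.exists_max_image {a : G | (Subgroup.zpowers a).Normal} orderOf
    (Set.toFinite _) ⟨1, by
      simp only [Set.mem_ofPred_eq, Subgroup.zpowers_one_eq_bot]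
      infer_instance⟩
  refine ⟨a, haN, ?_⟩
  by_contra! hcon
  obtain ⟨c₀, hc₀, hc₀a⟩ := hcon
  have hex : ∃ i, ∃ c ∈ Subgroup.upperCentralSeries G i, Commute c a ∧ c ∉ Subgroup.zpowers a := by
    obtain ⟨n, hn⟩ := Group.IsNilpotent.nilpotent G
    exact ⟨n, c₀, hn ▸ Subgroup.mem_top c₀, hc₀, hc₀a⟩
  classical
  obtain ⟨c, hcZ, hca, hcn⟩ := Nat.find_spec hex
  have hmin := fun j => Nat.find_min hex (m := j)
  set i := Nat.find hex
  have hcomm : ∀ g : G, c * g * c⁻¹ * g⁻¹ ∈ Subgroup.zpowers a := by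
    intro g
    rcases hi : i with _ | j
    · rw [hi, Subgroup.upperCentralSeries_zero, Subgroup.mem_bot] at hcZ
      simp [hcZ]
    · rw [hi, Subgroup.mem_upperCentralSeries_succ_iff] at hcZ
      by_contra hne
      refine hmin j (by lia) ⟨_, hcZ g, ?_, hne⟩
      obtain ⟨k, hk⟩ := haN.conj_mem a (Subgroup.mem_zpowers a) g⁻¹
      have h1 : Commute c (g⁻¹ * a * g) := by
        simp only [inv_inv] at hk
        rw [← hk]
        exact hca.zpow_right k
      have h2 : Commute (g * c⁻¹ * g⁻¹) a := by
        have := (h1.inv_left).map (MulAut.conj g)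
        simpa [mul_assoc] using this
      have := hca.mul_left h2
      simpa [mul_assoc, commutatorElement_def] using this
  have hC := commute_pair_isCyclic hcyc hca
  set H := Subgroup.closure {c, a} with hH
  have hcH : c ∈ H := Subgroup.subset_closure (by simp)
  have haH : Subgroup.zpowers a ≤ H := Subgroup.zpowers_le.2 (Subgroup.subset_closure (by simp))
  have hHN : H.Normal := by
    refine ⟨fun n hn g => ?_⟩
    have : H ≤ H.comap (MulAut.conj g).toMonoidHom := by
      conv_lhs => rw [hH]
      rw [Subgroup.closure_le]
      rintro s (rfl | rfl)
      · have := H.mul_mem (haH ((Subgroup.zpowers a).inv_mem (hcomm g))) hcH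
        simpa [mul_assoc] using this
      · have := haH (haN.conj_mem s (Subgroup.mem_zpowers s) g)
        simpa using this
    simpa using this hn
  obtain ⟨b, hb⟩ := (Subgroup.isCyclic_iff_exists_zpowers_eq_top H).1 hC
  have hle := hmax b (by simpa only [Set.mem_ofPred_eq, hb] using hHN)
  have : Subgroup.zpowers a = H := by
    apply Subgroup.eq_of_le_of_card_ge haH
    rw [← hb, Nat.card_zpowers, Nat.card_zpowers]
    exact hle
  exact hcn (this ▸ hcH)

theorem mul_zpow_pow_of_semiconjBy {G : Type*} [Group G] {a x : G} {r : ℤ}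
    (h : SemiconjBy x (a ^ r) a) (j : ℤ) (k : ℕ) :
    (x * a ^ j) ^ k = x ^ k * a ^ (j * ∑ i ∈ Finset.range k, r ^ i) := by
  induction k with
  | zero => simp
  | succ k ih =>
    have h1 := (h.zpow_right (j * ∑ i ∈ Finset.range k, r ^ i)).eq
    rw [← zpow_mul] at h1
    rw [pow_succ, ih, geom_sum_succ, mul_assoc, ← mul_assoc (a ^ _) x, ← h1, pow_succ, mul_assoc,
      ← zpow_add, mul_assoc]
    congr 3
    ring

theorem semiconjBy_pow_zpow {G : Type*} [Group G] {a x : G} {r : ℤ}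
    (h : SemiconjBy x (a ^ r) a) (k : ℕ) : SemiconjBy (x ^ k) (a ^ r ^ k) a := by
  induction k with
  | zero => simp
  | succ k ih =>
    have h1 := ih.zpow_right r
    rw [← zpow_mul, ← pow_succ] at h1
    rw [pow_succ']
    exact h.mul_left h1

theorem int_prime_dvd_sub_one_of_dvd_pow_sub_one {p : ℕ} (hp : p.Prime) {r : ℤ}
    (h : (p : ℤ) ∣ r ^ p - 1) : (p : ℤ) ∣ r - 1 := by
  have : Fact p.Prime := ⟨hp⟩
  rw [← ZMod.intCast_zmod_eq_zero_iff_dvd] at h ⊢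
  push_cast at h ⊢
  rwa [ZMod.pow_card] at h

theorem int_geom_sum_eq_mul_coprime {p : ℕ} (hodd : Odd p) {r : ℤ}
    (h : (p : ℤ) ∣ r - 1) :
    ∃ u : ℤ, ∑ i ∈ Finset.range p, r ^ i = p * u ∧ IsCoprime u (p : ℤ) := by
  obtain ⟨t, ht⟩ := h
  obtain ⟨s, hs⟩ := odd_sq_dvd_geom_sum₂_sub (R := ℤ) (a := 1) (b := t) hodd
  obtain rfl : r = 1 + p * t := by linarith
  simp only [one_pow, mul_one] at hs
  exact ⟨1 + p * s, by linear_combination hs, 1, -s, by ring⟩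

theorem action_of_prime_power_quotient {G : Type*} [Group G] {p n : ℕ} (hp : p.Prime) (hn : n ≠ 0)
    {a x : G} {r : ℤ} (ha : orderOf a = p ^ n) (hU : ∀ y : G, y ^ p = 1 → y ∈ Subgroup.zpowers a)
    (hx : x ∉ Subgroup.zpowers a) (hxp : x ^ p ∈ Subgroup.zpowers a)
    (h : SemiconjBy x (a ^ r) a) (hne : ¬ Commute x a) :
    p = 2 ∧ a ^ r = a⁻¹ ∧ x ^ 2 = a ^ 2 ^ (n - 1) := by
  have hdvd : ∀ k : ℤ, a ^ k = 1 ↔ (p : ℤ) ^ n ∣ k := fun k => by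
    rw [← orderOf_dvd_iff_zpow_eq_one, ha]; norm_cast
  have hdvd' : ∀ k l : ℤ, a ^ k = a ^ l ↔ (p : ℤ) ^ n ∣ k - l := fun k l => by
    rw [← hdvd, zpow_sub, mul_inv_eq_one]
  have hpZ : Prime (p : ℤ) := Nat.prime_iff_prime_int.1 hp
  obtain ⟨m, hm⟩ := hxp
  simp only at hm
  have h1 : (p : ℤ) ^ n ∣ (r - 1) * m := by
    have e1 := (h.zpow_right m).eq
    rw [← zpow_mul] at e1
    have e2 : Commute x (a ^ m) := by rw [hm]; exact Commute.self_pow x p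
    rw [← e2.eq] at e1
    have := (hdvd' _ _).1 (mul_left_cancel e1)
    rwa [sub_one_mul]
  have h2 : ¬ (p : ℤ) ^ n ∣ r - 1 := by
    intro hd
    rw [← hdvd', zpow_one] at hd
    rw [hd] at h
    exact hne h
  have h3 : (p : ℤ) ∣ m := by
    by_contra hpm
    have : IsCoprime ((p : ℤ) ^ n) m := ((hpZ.coprime_iff_not_dvd).2 hpm).pow_left
    exact h2 (this.dvd_of_dvd_mul_right h1)
  have h4 : (p : ℤ) ^ n ∣ r ^ p - 1 := by
    have e1 := (semiconjBy_pow_zpow h p).eq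
    have e2 : Commute (x ^ p) a := by rw [← hm]; exact (Commute.refl a).zpow_left m
    rw [← e2.eq] at e1
    rw [← hdvd', zpow_one]
    exact mul_left_cancel e1
  have h5 : (p : ℤ) ∣ r - 1 :=
    int_prime_dvd_sub_one_of_dvd_pow_sub_one hp ((dvd_pow_self _ hn).trans h4)
  have h6 : ∀ j : ℤ, ¬ (p : ℤ) ^ n ∣ m + j * ∑ i ∈ Finset.range p, r ^ i := by
    intro j hj
    apply hx
    have := hU (x * a ^ j) (by
      rw [mul_zpow_pow_of_semiconjBy h, ← hm, ← zpow_add]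
      exact (hdvd _).2 hj)
    rwa [Subgroup.mul_mem_cancel_right _ (Subgroup.zpow_mem _ (Subgroup.mem_zpowers a) j)] at this
  have h7 : ∀ u : ℤ, ∑ i ∈ Finset.range p, r ^ i = p * u → ¬ IsCoprime u (p : ℤ) := by
    intro u hu hcop
    obtain ⟨v, w, hvw⟩ := hcop.pow_right (n := n)
    obtain ⟨m', rfl⟩ := h3
    refine h6 (-m' * v) ⟨p * m' * w, ?_⟩
    rw [hu]
    linear_combination (-(p : ℤ) * m') * hvw
  rcases hp.eq_two_or_odd' with rfl | hodd
  · refine ⟨rfl, ?_⟩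
    obtain ⟨k, rfl⟩ := Nat.exists_eq_succ_of_ne_zero hn
    obtain ⟨t, ht⟩ := h5
    obtain rfl : r = 1 + 2 * t := by push_cast at ht; linarith
    clear ht
    simp only [Finset.sum_range_succ, Finset.sum_range_zero, Nat.cast_ofNat, Nat.succ_eq_add_one,
      Nat.add_sub_cancel, pow_zero, pow_one, zero_add] at *
    have hto : ¬ (2 : ℤ) ∣ t := by
      rintro ⟨s, rfl⟩
      exact h7 (1 + 2 * s) (by ring) ⟨1, -s, by ring⟩
    have hcop : IsCoprime ((2 : ℤ) ^ k) t := ((hpZ.coprime_iff_not_dvd).2 hto).pow_left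
    have hm2 : (2 : ℤ) ^ k ∣ m := by
      obtain ⟨q, hq⟩ := h1
      rw [pow_succ' 2] at hq
      exact hcop.dvd_of_dvd_mul_left ⟨q, by linarith⟩
    have hr2 : (2 : ℤ) ^ k ∣ 1 + (1 + 2 * t) := by
      obtain ⟨q, hq⟩ := h4
      rw [pow_succ' 2] at hq
      exact hcop.dvd_of_dvd_mul_left ⟨q, by linarith⟩
    obtain ⟨m', hm'⟩ := hm2
    obtain ⟨s, hs⟩ := hr2
    have hm'o : Odd m' := by
      rw [← Int.not_even_iff_odd]
      rintro ⟨q, rfl⟩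
      exact h6 0 ⟨q, by rw [hm']; ring⟩
    have hse : Even s := by
      rw [← Int.not_odd_iff_even]
      rintro ⟨q, rfl⟩
      obtain ⟨q', rfl⟩ := hm'o
      exact h6 1 ⟨q + q' + 1, by rw [hs, hm']; ring⟩
    constructor
    · rw [← zpow_neg_one, hdvd']
      obtain ⟨q, rfl⟩ := hse
      exact ⟨q, by linear_combination hs⟩
    · rw [← hm, ← zpow_natCast, hdvd']
      obtain ⟨q', rfl⟩ := hm'o
      exact ⟨q', by rw [hm']; push_cast; ring⟩
  · obtain ⟨u, hu, hcop⟩ := int_geom_sum_eq_mul_coprime hodd h5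
    exact absurd hcop (h7 u hu)

theorem nonempty_mulEquiv_quaternionGroup {G : Type*} [Group G] {k : ℕ} [NeZero k] {a x : G}
    (ha : orderOf a = 2 * k) (hx : x ∉ Subgroup.zpowers a) (hax : SemiconjBy x a⁻¹ a)
    (hx2 : x ^ 2 = a ^ k)
    (hcover : ∀ y, y ∉ Subgroup.zpowers a → x⁻¹ * y ∈ Subgroup.zpowers a) :
    Nonempty (G ≃* QuaternionGroup k) := by
  have hZ : ∀ i j : ℤ, a ^ i = a ^ j ↔ (i : ZMod (2 * k)) = j := fun i j => by
    rw [zpow_eq_zpow_iff_modEq, ha, ZMod.intCast_eq_intCast_iff]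
  let e : ZMod (2 * k) → G := fun i => a ^ (i.cast : ℤ)
  have he : ∀ i : ℤ, e i = a ^ i := fun i => by simp [e, hZ]
  have hxe : ∀ i : ℤ, a ^ i * x = x * a ^ (-i) := fun i => by
    have := (hax.zpow_right i).eq
    rw [inv_zpow'] at this
    exact this.symm
  have hxx : x * x = a ^ (k : ℤ) := by rw [← sq, hx2, zpow_natCast]
  let f : QuaternionGroup k → G
    | .a i => e i
    | .xa i => x * e i
  have hmem : ∀ i : ℤ, x * a ^ i ∉ Subgroup.zpowers a := fun i => by
    rwa [Subgroup.mul_mem_cancel_right _ (Subgroup.zpow_mem _ (Subgroup.mem_zpowers a) i)]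
  have hmul : ∀ g h, f (g * h) = f g * f h := by
    rintro (i | i) (j | j) <;> obtain ⟨i, rfl⟩ := ZMod.intCast_surjective i <;>
      obtain ⟨j, rfl⟩ := ZMod.intCast_surjective j
    · simp only [QuaternionGroup.a_mul_a, f, ← Int.cast_add, he, zpow_add]
    · simp only [QuaternionGroup.a_mul_xa, f, ← Int.cast_sub, he]
      rw [← mul_assoc, hxe, mul_assoc, ← zpow_add, neg_add_eq_sub]
    · simp only [QuaternionGroup.xa_mul_a, f, ← Int.cast_add, he, zpow_add, mul_assoc]
    · have : ((k : ZMod (2 * k)) + (j : ZMod (2 * k)) - i) = ((k + j - i : ℤ) : ZMod (2 * k)) := by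
        push_cast; rfl
      simp only [QuaternionGroup.xa_mul_xa, f, this, he]
      rw [mul_assoc, ← mul_assoc (a ^ i), hxe, mul_assoc, ← mul_assoc x, hxx, ← zpow_add,
        ← zpow_add]
      ring_nf
  have hinj : Function.Injective f := by
    rintro (i | i) (j | j) hij <;> obtain ⟨i, rfl⟩ := ZMod.intCast_surjective i <;>
      obtain ⟨j, rfl⟩ := ZMod.intCast_surjective j <;> simp only [f, he] at hij
    · rw [(hZ i j).1 hij]
    · exact absurd ⟨i, hij⟩ (hmem j)
    · exact absurd ⟨j, hij.symm⟩ (hmem i)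
    · rw [(hZ i j).1 (mul_left_cancel hij)]
  have hsurj : Function.Surjective f := by
    intro y
    by_cases hy : y ∈ Subgroup.zpowers a
    · obtain ⟨i, rfl⟩ := hy
      exact ⟨.a i, he i⟩
    · obtain ⟨i, hi⟩ := hcover y hy
      refine ⟨.xa i, ?_⟩
      simp only [f, he]
      simp only at hi
      rw [hi, mul_inv_cancel_left]
  exact ⟨(MulEquiv.ofBijective (MulHom.mk f hmul) ⟨hinj, hsurj⟩).symm⟩

theorem stmt7 (p : ℕ) (hp : p.Prime) (P : Type*) [Group P] [Fintype P]
    (hP : IsPGroup p P) (hnt : Nontrivial P)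
    (hcyc : ∀ H : Subgroup P, (∀ a b : H, a * b = b * a) → IsCyclic H) :
    IsCyclic P ∨ (p = 2 ∧ IsGeneralizedQuaternion P) := by
  have : Fact p.Prime := ⟨hp⟩
  have := hP.isNilpotent
  obtain ⟨a, haN, hcent⟩ := exists_self_centralizing_cyclic_normal hcyc
  by_cases htop : Subgroup.zpowers a = ⊤
  · exact Or.inl (isCyclic_iff_exists_zpowers_eq_top.2 ⟨a, htop⟩)
  right
  have ha1 : a ≠ 1 := by
    rintro rfl
    exact htop ((Subgroup.eq_top_iff' _).2 fun c => hcent c (Commute.one_right c))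
  obtain ⟨n, hn⟩ := IsPGroup.iff_orderOf.1 hP a
  have hn0 : n ≠ 0 := by
    rintro rfl
    exact ha1 (orderOf_eq_one_iff.1 (by simpa using hn))
  have hU := fun y : P => mem_zpowers_of_pow_prime_eq_one (y := y) hp hP hcyc ha1
  have hconj : ∀ x : P, ∃ r : ℤ, SemiconjBy x (a ^ r) a := by
    intro x
    obtain ⟨r, hr⟩ := haN.conj_mem a (Subgroup.mem_zpowers a) x⁻¹
    refine ⟨r, ?_⟩
    simp only [inv_inv] at hr
    rw [hr, SemiconjBy]
    group
  have key : ∀ x : P, x ∉ Subgroup.zpowers a → x ^ p ∈ Subgroup.zpowers a →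
      p = 2 ∧ SemiconjBy x a⁻¹ a ∧ x ^ 2 = a ^ 2 ^ (n - 1) := by
    intro x hx hxp
    obtain ⟨r, hr⟩ := hconj x
    obtain ⟨h1, h2, h3⟩ := action_of_prime_power_quotient hp hn0 hn hU hx hxp hr
      (fun hc => hx (hcent x hc))
    exact ⟨h1, h2 ▸ hr, h3⟩
  have hlast : ∀ y : P, y ∉ Subgroup.zpowers a → ∃ k : ℕ, y ^ p ^ k ∉ Subgroup.zpowers a ∧
      y ^ p ^ (k + 1) ∈ Subgroup.zpowers a := by
    classical
    intro y hy
    have hex : ∃ k, y ^ p ^ k ∈ Subgroup.zpowers a := by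
      obtain ⟨k, hk⟩ := (isPGroup_iff_pow_pow_eq_one.1 hP) y
      exact ⟨k, hk ▸ Subgroup.one_mem _⟩
    have h0 : Nat.find hex ≠ 0 := fun h => hy (by simpa [h] using Nat.find_spec hex)
    refine ⟨Nat.find hex - 1, Nat.find_min hex (by lia), ?_⟩
    rw [Nat.sub_add_cancel (Nat.pos_of_ne_zero h0)]
    exact Nat.find_spec hex
  obtain ⟨x₀, hx₀⟩ : ∃ x, x ∉ Subgroup.zpowers a := by
    by_contra! hall
    exact htop ((Subgroup.eq_top_iff' _).2 hall)
  obtain rfl : p = 2 := by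
    obtain ⟨k, hk1, hk2⟩ := hlast x₀ hx₀
    exact (key _ hk1 (by rwa [← pow_mul, ← pow_succ])).1
  have hn1 : n ≠ 1 := by
    rintro rfl
    obtain ⟨k, hk1, hk2⟩ := hlast x₀ hx₀
    have h1 := (key _ hk1 (by rwa [← pow_mul, ← pow_succ])).2.1
    have h2 : a⁻¹ = a := inv_eq_of_mul_eq_one_left (by
      rw [← sq]; exact orderOf_dvd_iff_pow_eq_one.1 (by simp [hn]))
    rw [h2] at h1
    exact hk1 (hcent _ h1)
  have hall : ∀ y, y ∉ Subgroup.zpowers a → SemiconjBy y a⁻¹ a ∧ y ^ 2 = a ^ 2 ^ (n - 1) := by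
    intro y hy
    obtain ⟨k, hk1, hk2⟩ := hlast y hy
    have hk := (key _ hk1 (by rwa [← pow_mul, ← pow_succ])).2.1
    rcases k with _ | k
    · exact (key y hy (by simpa using hk2)).2
    · exfalso
      obtain ⟨s, hs⟩ := hconj (y ^ 2 ^ k)
      have hs2 := semiconjBy_pow_zpow hs 2
      rw [← pow_mul, ← pow_succ] at hs2
      have h1 : a ^ s ^ 2 = a ^ (-1 : ℤ) := by
        rw [zpow_neg_one]
        exact mul_left_cancel (hs2.eq.trans hk.eq.symm)
      rw [zpow_eq_zpow_iff_modEq, hn] at h1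
      have h4 : s ^ 2 ≡ -1 [ZMOD 4] := h1.of_dvd (by
        have := pow_dvd_pow 2 (show 2 ≤ n by lia)
        exact_mod_cast this)
      have hs4 : (s : ZMod 4) ^ 2 = -1 := by
        have := (ZMod.intCast_eq_intCast_iff _ _ 4).2 h4
        exact_mod_cast this
      revert hs4
      generalize (s : ZMod 4) = q
      revert q
      decide
  refine ⟨rfl, n + 1, by lia, ?_⟩
  have hsub : n + 1 - 2 = n - 1 := by lia
  rw [hsub]
  obtain ⟨h1, h2⟩ := hall x₀ hx₀
  refine nonempty_mulEquiv_quaternionGroup ?_ hx₀ h1 h2 ?_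
  · rw [hn, ← pow_succ', Nat.sub_add_cancel (Nat.pos_of_ne_zero hn0)]
  · intro y hy
    apply hcent
    have h3 := (hall y hy).1
    have h4 : SemiconjBy x₀⁻¹ a⁻¹ a := by simpa using h1.inv_symm_left.inv_right
    exact h4.mul_left (by simpa using h3.inv_right)
end
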